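/- Assume −ϑ0 + Σ_{l=1}^d ν_l²/(4η) + π²ηd > 0, so that λ_k > 0 for every multi-index k of positive integers. Let α' ∈ (0,1), α := d/2 − 1 + α', and fix τ ≥ 0. Then there exist constants C > 0 and Δ₀ ∈ (0,1) (possibly depending on τ) such that for every Δ ∈ (0,Δ₀], | Δ^{d/2} Σ_{k ∈ (ℕ_{≥1})^d} g_{α,τ}(λ_k Δ) − (1/2)(2(τ+1)^{α'} − τ^{α'} − (τ+2)^{α'}) · Γ(1−α')/(2^{d}(πη)^{d/2} α' Γ(d/2)) + Σ_{γ ∈ {0,1}^d, 1 ≤ ‖γ‖₁ ≤ d−1} ∫_{B_γ(Δ)} g_{α,τ}(π²η‖z‖²) dz | ≤ C · Δ^{1−α'}, where 0^{α'} := 0. -/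

import Mathlib

open MeasureTheory

/-- The signed second difference in `b ∈ {τ, τ + 1, τ + 2}` of `b ^ j * exp (-b x)`. -/
noncomputable def expSecondDiff (τ : ℝ) (j : ℕ) (x : ℝ) : ℝ :=
  τ ^ j * Real.exp (-(τ * x)) - 2 * ((τ + 1) ^ j * Real.exp (-((τ + 1) * x)))
    + (τ + 2) ^ j * Real.exp (-((τ + 2) * x))

/-- The integrable majorant `x ^ (-α) / (1 + x)`. -/
noncomputable def decayKernel (α x : ℝ) : ℝ := x ^ (-α) / (1 + x)

/-- The kernel `(1 - exp (-x)) ^ 2 * exp (-τ x) / (2 x ^ (1 + α))`. -/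
noncomputable def incrementKernel (α τ x : ℝ) : ℝ :=
  (1 - Real.exp (-x)) ^ 2 * Real.exp (-(τ * x)) / (2 * x ^ (1 + α))

lemma expSecondDiff_zero (τ x : ℝ) :
    expSecondDiff τ 0 x = (1 - Real.exp (-x)) ^ 2 * Real.exp (-(τ * x)) := by
  have e1 : Real.exp (-((τ + 1) * x)) = Real.exp (-(τ * x)) * Real.exp (-x) := by
    rw [← Real.exp_add]; ring_nf
  have e2 : Real.exp (-((τ + 2) * x)) = Real.exp (-(τ * x)) * Real.exp (-x) ^ 2 := by
    rw [← Real.exp_nat_mul, ← Real.exp_add]; push_cast; ring_nf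
  rw [expSecondDiff, e1, e2]; ring

lemma hasDerivAt_expSecondDiff (τ : ℝ) (j : ℕ) (x : ℝ) :
    HasDerivAt (expSecondDiff τ j) (-expSecondDiff τ (j + 1) x) x := by
  have key (b : ℝ) : HasDerivAt (fun x => b ^ j * Real.exp (-(b * x)))
      (-(b ^ (j + 1) * Real.exp (-(b * x)))) x := by
    have h : HasDerivAt (fun x : ℝ => -(b * x)) (-(b * 1)) x :=
      ((hasDerivAt_id x).const_mul b).neg
    refine (h.exp.const_mul (b ^ j)).congr_deriv ?_
    ring
  refine (((key τ).sub ((key (τ + 1)).const_mul 2)).add (key (τ + 2))).congr_deriv ?_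
  rw [expSecondDiff]; ring

lemma abs_expSecondDiff_le_of_forall {τ x M : ℝ} {j : ℕ} (hτ : 0 ≤ τ)
    (h : ∀ b ∈ Set.Icc 0 (τ + 2), b ^ j * Real.exp (-(b * x)) ≤ M) :
    |expSecondDiff τ j x| ≤ 4 * M := by
  have p0 : 0 ≤ τ ^ j * Real.exp (-(τ * x)) := by positivity
  have p1 : 0 ≤ (τ + 1) ^ j * Real.exp (-((τ + 1) * x)) := by positivity
  have p2 : 0 ≤ (τ + 2) ^ j * Real.exp (-((τ + 2) * x)) := by positivity
  have h0 := h τ ⟨hτ, by linarith⟩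
  have h1 := h (τ + 1) ⟨by linarith, by linarith⟩
  have h2 := h (τ + 2) ⟨by linarith, by linarith⟩
  rw [expSecondDiff, abs_le]
  constructor <;> linarith

lemma abs_expSecondDiff_le {τ x : ℝ} (hτ : 0 ≤ τ) (hx : 0 ≤ x) (j : ℕ) :
    |expSecondDiff τ j x| ≤ 4 * (τ + 2) ^ j := by
  refine abs_expSecondDiff_le_of_forall hτ fun b hb => ?_
  have hb0 := hb.1
  have : Real.exp (-(b * x)) ≤ 1 := Real.exp_le_one_iff.2 (by nlinarith)
  calc b ^ j * Real.exp (-(b * x)) ≤ b ^ j * 1 := by gcongr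
    _ ≤ (τ + 2) ^ j := by rw [mul_one]; exact pow_le_pow_left₀ hb0 hb.2 j

lemma abs_expSecondDiff_succ_mul_le {τ x : ℝ} (hτ : 0 ≤ τ) (hx : 0 < x) (j : ℕ) :
    |expSecondDiff τ (j + 1) x| * x ≤ 4 * (τ + 2) ^ j := by
  rw [← le_div_iff₀ hx, mul_div_assoc]
  refine abs_expSecondDiff_le_of_forall hτ fun b hb => ?_
  have hb0 := hb.1
  rw [le_div_iff₀ hx]
  have h1 : b * x * Real.exp (-(b * x)) ≤ 1 := by
    rw [Real.exp_neg, ← div_eq_mul_inv, div_le_one (Real.exp_pos _)]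
    linarith [Real.add_one_le_exp (b * x)]
  calc b ^ (j + 1) * Real.exp (-(b * x)) * x = b ^ j * (b * x * Real.exp (-(b * x))) := by ring
    _ ≤ b ^ j * 1 := by gcongr
    _ ≤ (τ + 2) ^ j := by rw [mul_one]; exact pow_le_pow_left₀ hb0 hb.2 j

lemma abs_expSecondDiff_one_le {τ x : ℝ} (hτ : 0 ≤ τ) (hx : 0 ≤ x) :
    |expSecondDiff τ 1 x| ≤ 4 * (τ + 2) ^ 2 * x := by
  have h0 : expSecondDiff τ 1 0 = 0 := by simp [expSecondDiff]; ring
  have := Convex.norm_image_sub_le_of_norm_hasDerivWithin_le (s := Set.Ici (0 : ℝ))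
    (f := expSecondDiff τ 1) (C := 4 * (τ + 2) ^ 2) (x := 0) (y := x)
    (fun y _ => (hasDerivAt_expSecondDiff τ 1 y).hasDerivWithinAt)
    (fun y hy => by
      rw [norm_neg, Real.norm_eq_abs]; exact abs_expSecondDiff_le hτ hy 2)
    (convex_Ici 0) Set.self_mem_Ici hx
  simpa [h0, abs_of_nonneg hx] using this

lemma expSecondDiff_zero_nonneg (τ x : ℝ) : 0 ≤ expSecondDiff τ 0 x := by
  rw [expSecondDiff_zero]; positivity

lemma expSecondDiff_zero_le {τ x : ℝ} (hτ : 0 ≤ τ) (hx : 0 ≤ x) :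
    expSecondDiff τ 0 x ≤ 1 ∧ expSecondDiff τ 0 x ≤ x ∧ expSecondDiff τ 0 x ≤ x ^ 2 := by
  have h1 : Real.exp (-(τ * x)) ≤ 1 := Real.exp_le_one_iff.2 (by nlinarith)
  have h2 : Real.exp (-x) ≤ 1 := Real.exp_le_one_iff.2 (by linarith)
  have h3 : 1 - Real.exp (-x) ≤ x := by linarith [Real.add_one_le_exp (-x)]
  have h4 := Real.exp_pos (-x)
  have h5 : expSecondDiff τ 0 x ≤ (1 - Real.exp (-x)) ^ 2 := by
    rw [expSecondDiff_zero]
    exact mul_le_of_le_one_right (by positivity) h1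
  refine ⟨?_, ?_, ?_⟩ <;> nlinarith

lemma decayKernel_nonneg {α x : ℝ} (hx : 0 ≤ x) : 0 ≤ decayKernel α x := by
  unfold decayKernel; positivity

lemma decayKernel_anti {α x y : ℝ} (hα : 0 ≤ α) (hx : 0 < x) (hxy : x ≤ y) :
    decayKernel α y ≤ decayKernel α x := by
  unfold decayKernel
  have := Real.rpow_le_rpow_of_nonpos hx hxy (neg_nonpos.2 hα)
  gcongr

lemma decayKernel_mul_le {α x ε : ℝ} (hε : 0 < ε) (hε1 : ε ≤ 1) (hx : 0 < x) :
    decayKernel α (ε * x) ≤ ε ^ (-α) / ε * decayKernel α x := by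
  unfold decayKernel
  rw [Real.mul_rpow hε.le hx.le, div_mul_div_comm]
  gcongr
  nlinarith

lemma rpow_eq_decayKernel_mul {α x : ℝ} (hx : 0 < x) :
    x ^ (-α) = decayKernel α x * (1 + x) := by
  unfold decayKernel; field_simp

lemma incrementKernel_eq {α τ x : ℝ} (hx : 0 < x) :
    incrementKernel α τ x = expSecondDiff τ 0 x * x ^ (-(1 + α)) / 2 := by
  rw [incrementKernel, ← expSecondDiff_zero, Real.rpow_neg hx.le]
  have := Real.rpow_pos_of_pos hx (1 + α)
  field_simp

lemma incrementKernel_nonneg {α τ x : ℝ} (hx : 0 ≤ x) : 0 ≤ incrementKernel α τ x := by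
  unfold incrementKernel; positivity

lemma rpow_neg_one_add {α x : ℝ} (hx : 0 < x) : x ^ (-(1 + α)) = x ^ (-α) / x := by
  rw [← Real.rpow_sub_one hx.ne']; ring_nf

lemma incrementKernel_le {α τ x : ℝ} (hτ : 0 ≤ τ) (hx : 0 < x) :
    incrementKernel α τ x ≤ decayKernel α x ∧ incrementKernel α τ x ≤ x * decayKernel α x := by
  obtain ⟨h1, h2, h3⟩ := expSecondDiff_zero_le hτ hx.le
  have h0 := expSecondDiff_zero_nonneg τ x
  have hW := decayKernel_nonneg (α := α) hx.le
  rw [incrementKernel_eq hx, rpow_neg_one_add hx, rpow_eq_decayKernel_mul hx]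
  have e : expSecondDiff τ 0 x * (decayKernel α x * (1 + x) / x) / 2
      = (expSecondDiff τ 0 x * (1 + x)) / (2 * x) * decayKernel α x := by field_simp
  rw [e]
  constructor
  · refine mul_le_of_le_one_left hW ((div_le_one (by positivity)).2 (by nlinarith))
  · gcongr
    rw [div_le_iff₀ (by positivity)]
    nlinarith

/-- First and second derivatives of the kernel, with bounds by the decay kernel. -/
lemma exists_deriv_bounds_incrementKernel {α τ : ℝ} (hα : 0 ≤ α) (hτ : 0 ≤ τ) :
    ∃ g₁ g₂ : ℝ → ℝ, ∃ C > 0, ∀ x > 0,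
      HasDerivAt (incrementKernel α τ) (g₁ x) x ∧ HasDerivAt g₁ (g₂ x) x ∧
      |g₁ x| ≤ C * decayKernel α x ∧ |g₂ x| ≤ C * decayKernel α x / x := by
  set K := 4 * (τ + 2) ^ 2 with hK
  refine ⟨fun x => (-expSecondDiff τ 1 x * x ^ (-(1 + α))
      + expSecondDiff τ 0 x * (-(1 + α) * x ^ (-(1 + α) - 1))) / 2,
    fun x => (expSecondDiff τ 2 x * x ^ (-(1 + α))
      - 2 * expSecondDiff τ 1 x * (-(1 + α) * x ^ (-(1 + α) - 1))
      + expSecondDiff τ 0 x * (-(1 + α) * ((-(1 + α) - 1) * x ^ (-(1 + α) - 1 - 1)))) / 2,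
    K + 2 * (1 + α) * K + (1 + α) * (2 + α), by positivity, fun x hx => ⟨?_, ?_, ?_, ?_⟩⟩
  · have h := ((hasDerivAt_expSecondDiff τ 0 x).mul
      (Real.hasDerivAt_rpow_const (p := -(1 + α)) (Or.inl hx.ne'))).div_const 2
    refine (h.congr_of_eventuallyEq ?_)
    filter_upwards [lt_mem_nhds hx] with y hy
    exact incrementKernel_eq hy
  · have h := (((hasDerivAt_expSecondDiff τ 1 x).neg.mul
      (Real.hasDerivAt_rpow_const (p := -(1 + α)) (Or.inl hx.ne'))).add
      ((hasDerivAt_expSecondDiff τ 0 x).mul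
      ((Real.hasDerivAt_rpow_const (p := -(1 + α) - 1) (Or.inl hx.ne')).const_mul
        (-(1 + α))))).div_const 2
    refine h.congr_deriv ?_
    simp only [Nat.reduceAdd, zero_add]
    simp only [Pi.neg_apply]
    ring
  all_goals
    obtain ⟨h1, h2, h3⟩ := expSecondDiff_zero_le hτ hx.le
    have h0 := expSecondDiff_zero_nonneg τ x
    have hW := decayKernel_nonneg (α := α) hx.le
    have a1 := abs_expSecondDiff_one_le hτ hx.le
    have a2 := abs_expSecondDiff_le hτ hx.le 1
    have a3 := abs_expSecondDiff_le hτ hx.le 2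
    have a4 := abs_expSecondDiff_succ_mul_le hτ hx 1
    have a5 := abs_expSecondDiff_succ_mul_le hτ hx 0
    norm_num at a2 a4 a5
    have b0 : |expSecondDiff τ 0 x| * (1 + x) ≤ 2 * x ^ 2 := by
      rw [abs_of_nonneg h0]; nlinarith
    have b1 : |expSecondDiff τ 1 x| * (1 + x) ≤ 2 * K * x := by
      have : 1 ≤ (τ + 2) ^ 2 := by nlinarith
      have : 4 * (τ + 2) ≤ K := by rw [hK]; nlinarith
      nlinarith
    have b2 : |expSecondDiff τ 2 x| * (1 + x) ≤ 2 * K := by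
      have : 4 * (τ + 2) ≤ K := by rw [hK]; nlinarith
      nlinarith
    have hK0 : 0 < K := by positivity
    simp only [Real.rpow_sub_one hx.ne', rpow_neg_one_add hx, rpow_eq_decayKernel_mul hx]
    generalize decayKernel α x = W at *
    generalize expSecondDiff τ 0 x = E0 at *
    generalize expSecondDiff τ 1 x = E1 at *
    try generalize expSecondDiff τ 2 x = E2 at *
  · have e : (-E1 * (W * (1 + x) / x) + E0 * (-(1 + α) * (W * (1 + x) / x / x))) / 2
        = -(W * ((E1 * (1 + x)) / x + (1 + α) * ((E0 * (1 + x)) / x ^ 2)) / 2) := by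
      field_simp
      ring
    rw [e, abs_neg, abs_div, abs_mul, abs_of_nonneg hW, abs_two]
    have c1 : |E1 * (1 + x) / x| ≤ 2 * K := by
      rw [abs_div, abs_mul, abs_of_pos hx, abs_of_pos (by linarith : 0 < 1 + x)]
      exact (div_le_iff₀ hx).2 b1
    have c0 : |E0 * (1 + x) / x ^ 2| ≤ 2 := by
      rw [abs_div, abs_mul, abs_of_pos (pow_pos hx 2), abs_of_pos (by linarith : 0 < 1 + x)]
      exact (div_le_iff₀ (by positivity)).2 b0
    have c : |E1 * (1 + x) / x + (1 + α) * (E0 * (1 + x) / x ^ 2)|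
        ≤ 2 * K + (1 + α) * 2 := by
      refine (abs_add_le _ _).trans ?_
      rw [abs_mul, abs_of_pos (by linarith : 0 < 1 + α)]
      gcongr
    calc W * |E1 * (1 + x) / x + (1 + α) * (E0 * (1 + x) / x ^ 2)| / 2
        ≤ W * (2 * K + (1 + α) * 2) / 2 := by gcongr
      _ = (K + (1 + α)) * W := by ring
      _ ≤ _ := by
        refine mul_le_mul_of_nonneg_right ?_ hW
        have : 0 ≤ (1 + α) * K := by positivity
        nlinarith
  · have e : (E2 * (W * (1 + x) / x) - 2 * E1 * (-(1 + α) * (W * (1 + x) / x / x))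
          + E0 * (-(1 + α) * ((-(1 + α) - 1) * (W * (1 + x) / x / x / x)))) / 2
        = W * (E2 * (1 + x) + 2 * (1 + α) * ((E1 * (1 + x)) / x)
          + (1 + α) * (2 + α) * ((E0 * (1 + x)) / x ^ 2)) / (2 * x) := by
      field_simp
      ring
    rw [e, abs_div, abs_mul, abs_of_nonneg hW, abs_of_pos (by positivity : 0 < 2 * x)]
    have c2 : |E2 * (1 + x)| ≤ 2 * K := by
      rwa [abs_mul, abs_of_pos (by linarith : 0 < 1 + x)]
    have c1 : |E1 * (1 + x) / x| ≤ 2 * K := by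
      rw [abs_div, abs_mul, abs_of_pos hx, abs_of_pos (by linarith : 0 < 1 + x)]
      exact (div_le_iff₀ hx).2 b1
    have c0 : |E0 * (1 + x) / x ^ 2| ≤ 2 := by
      rw [abs_div, abs_mul, abs_of_pos (pow_pos hx 2), abs_of_pos (by linarith : 0 < 1 + x)]
      exact (div_le_iff₀ (by positivity)).2 b0
    have c : |E2 * (1 + x) + 2 * (1 + α) * ((E1 * (1 + x)) / x)
          + (1 + α) * (2 + α) * ((E0 * (1 + x)) / x ^ 2)|
        ≤ 2 * K + 2 * (1 + α) * (2 * K) + (1 + α) * (2 + α) * 2 := by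
      refine (abs_add_three _ _ _).trans ?_
      rw [abs_mul (2 * (1 + α)), abs_mul ((1 + α) * (2 + α)),
        abs_of_pos (by positivity : 0 < 2 * (1 + α)),
        abs_of_pos (by positivity : 0 < (1 + α) * (2 + α))]
      gcongr
    rw [div_le_div_iff₀ (by positivity) hx]
    nlinarith [mul_le_mul_of_nonneg_left c hW]

/-- Second-order Taylor bound on a half-line. -/
lemma abs_sub_sub_mul_le_of_deriv_bound {g g₁ g₂ : ℝ → ℝ} {m K : ℝ}
    (h₁ : ∀ x ≥ m, HasDerivAt g (g₁ x) x) (h₂ : ∀ x ≥ m, HasDerivAt g₁ (g₂ x) x)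
    (hK : ∀ x ≥ m, |g₂ x| ≤ K) {x y : ℝ} (hx : m ≤ x) (hy : m ≤ y) :
    |g y - g x - g₁ x * (y - x)| ≤ K * (y - x) ^ 2 := by
  have hK0 : 0 ≤ K := (abs_nonneg _).trans (hK m le_rfl)
  have hsub : Set.uIcc x y ⊆ Set.Ici m := fun t ht => (le_inf hx hy).trans ht.1
  have hlip (t : ℝ) (ht : t ∈ Set.uIcc x y) : |g₁ t - g₁ x| ≤ K * |y - x| := by
    refine (Convex.norm_image_sub_le_of_norm_hasDerivWithin_le (s := Set.Ici m) (f := g₁)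
      (fun z hz => (h₂ z hz).hasDerivWithinAt) (fun z hz => hK z hz) (convex_Ici m)
      hx (hsub ht)).trans ?_
    exact mul_le_mul_of_nonneg_left (Set.abs_sub_left_of_mem_uIcc ht) hK0
  have := Convex.norm_image_sub_le_of_norm_hasDerivWithin_le (s := Set.uIcc x y)
    (f := fun t => g t - g₁ x * t) (f' := fun t => g₁ t - g₁ x * 1) (C := K * |y - x|)
    (fun z hz => ((h₁ z (hsub hz)).sub ((hasDerivAt_id z).const_mul (g₁ x))).hasDerivWithinAt)
    (fun z hz => by rw [mul_one]; exact hlip z hz) (convex_uIcc x y)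
    Set.left_mem_uIcc Set.right_mem_uIcc
  rw [Real.norm_eq_abs, Real.norm_eq_abs, mul_assoc, ← abs_mul, ← sq, abs_sq] at this
  convert this using 2
  ring

/-- Polar coordinates for functions of the squared Euclidean norm on `Fin d → ℝ`. -/
lemma integrable_sum_sq_of_integrableOn {d : ℕ} (hd : d ≠ 0) {φ : ℝ → ℝ}
    (h : IntegrableOn (fun r : ℝ => r ^ (d - 1) * φ (r ^ 2)) (Set.Ioi 0)) :
    Integrable (fun z : Fin d → ℝ => φ (∑ i, z i ^ 2)) := by
  have : Nonempty (Fin d) := Fin.pos_iff_nonempty.1 (Nat.pos_of_ne_zero hd)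
  rw [← (PiLp.volume_preserving_ofLp (Fin d)).integrable_comp_emb
    (MeasurableEquiv.toLp 2 (Fin d → ℝ)).symm.measurableEmbedding]
  have := (integrable_fun_norm_addHaar (volume : Measure (EuclideanSpace ℝ (Fin d)))
    (f := fun r => φ (r ^ 2))).2 (by simpa using h)
  refine this.congr (Filter.Eventually.of_forall fun z => ?_)
  simp [EuclideanSpace.norm_sq_eq]

lemma integral_sum_sq {d : ℕ} (hd : d ≠ 0) (φ : ℝ → ℝ) :
    ∫ z : Fin d → ℝ, φ (∑ i, z i ^ 2) =
      d * (√Real.pi ^ d / Real.Gamma ((d : ℝ) / 2 + 1)) *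
        ∫ r in Set.Ioi (0 : ℝ), r ^ (d - 1) * φ (r ^ 2) := by
  have : Nonempty (Fin d) := Fin.pos_iff_nonempty.1 (Nat.pos_of_ne_zero hd)
  rw [← (PiLp.volume_preserving_ofLp (Fin d)).integral_comp
    (MeasurableEquiv.toLp 2 (Fin d → ℝ)).symm.measurableEmbedding]
  have := integral_fun_norm_addHaar (volume : Measure (EuclideanSpace ℝ (Fin d)))
    (fun r => φ (r ^ 2))
  have hG : 0 < Real.Gamma ((d : ℝ) / 2 + 1) := Real.Gamma_pos_of_pos (by positivity)
  simp only [EuclideanSpace.norm_sq_eq, Real.norm_eq_abs, sq_abs, finrank_euclideanSpace,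
    Fintype.card_fin, smul_eq_mul, nsmul_eq_mul, Measure.real, EuclideanSpace.volume_ball,
    ENNReal.ofReal_one, one_pow, one_mul] at this
  rw [ENNReal.toReal_ofReal (by positivity)] at this
  rw [this, mul_assoc]

lemma map_abs_volume :
    (volume : Measure ℝ).map (fun x => |x|) = (2 : ENNReal) • volume.restrict (Set.Ici 0) := by
  ext s hs
  have hs' : MeasurableSet ((fun x : ℝ => |x|) ⁻¹' s) := measurable_abs hs
  rw [Measure.map_apply measurable_abs hs, Measure.smul_apply, Measure.restrict_apply hs,
    ← measure_inter_add_sdiff _ (measurableSet_Ici (a := (0 : ℝ)))]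
  have e1 : (fun x : ℝ => |x|) ⁻¹' s ∩ Set.Ici 0 = s ∩ Set.Ici 0 := by
    ext x
    simp only [Set.mem_inter_iff, Set.mem_preimage, Set.mem_Ici, and_congr_left_iff]
    intro hx
    rw [abs_of_nonneg hx]
  have e2 : (fun x : ℝ => |x|) ⁻¹' s \ Set.Ici 0 = Neg.neg ⁻¹' (s ∩ Set.Ioi 0) := by
    ext x
    simp only [Set.mem_sdiff, Set.mem_inter_iff, Set.mem_preimage, Set.mem_Ici, Set.mem_Ioi,
      not_le, Left.neg_pos_iff, and_congr_left_iff]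
    intro hx
    rw [abs_of_neg hx]
  have e3 : volume (s ∩ Set.Ioi (0 : ℝ)) = volume (s ∩ Set.Ici 0) :=
    measure_congr ((ae_eq_refl s).inter Ioi_ae_eq_Ici)
  rw [e1, e2, Measure.measure_preimage_neg, e3, smul_eq_mul, two_mul]

lemma integral_sum_sq_orthant {d : ℕ} {φ : ℝ → ℝ} (hφ : Measurable φ) :
    ∫ z in Set.univ.pi fun _ : Fin d => Set.Ici (0 : ℝ), φ (∑ i, z i ^ 2) =
      (∫ z : Fin d → ℝ, φ (∑ i, z i ^ 2)) / 2 ^ d := by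
  have hmap : (volume : Measure (Fin d → ℝ)).map (fun z i => |z i|)
      = (2 : ENNReal) ^ d • volume.restrict (Set.univ.pi fun _ => Set.Ici 0) := by
    have hsf : SigmaFinite ((2 : ENNReal) • (volume : Measure ℝ).restrict (Set.Ici 0)) := by
      rw [two_smul]; infer_instance
    have hsf' : SigmaFinite ((volume : Measure ℝ).map (fun x => |x|)) := by
      rwa [map_abs_volume]
    have h := Measure.pi_map_pi (μ := fun _ : Fin d => (volume : Measure ℝ))
      (f := fun _ x => |x|) (hμ := fun _ => hsf') fun _ => measurable_abs.aemeasurable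
    simp only [map_abs_volume] at h
    rw [volume_pi, h, Measure.restrict_pi_pi]
    refine @Measure.pi_eq _ _ _ _ _ (fun _ => hsf) _ fun s _ => ?_
    simp [Finset.prod_mul_distrib]
  have hmeas : Measurable fun z : Fin d → ℝ => fun i => |z i| := by fun_prop
  have h := integral_map hmeas.aemeasurable (μ := (volume : Measure (Fin d → ℝ)))
    (f := fun z => φ (∑ i, z i ^ 2)) (by
      exact (hφ.comp (by fun_prop)).aestronglyMeasurable)
  simp only [sq_abs] at h
  rw [hmap, integral_smul_measure] at h
  rw [← h]
  simp

lemma integrable_decayKernel_sum_sq {d : ℕ} (hd : d ≠ 0) {α : ℝ} (hα : (d : ℝ) / 2 - 1 < α)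
    (hα' : α < d / 2) : Integrable (fun z : Fin d → ℝ => decayKernel α (∑ i, z i ^ 2)) := by
  refine integrable_sum_sq_of_integrableOn hd ?_
  have e (r : ℝ) (hr : 0 < r) : r ^ (d - 1) * decayKernel α (r ^ 2)
      = r ^ ((d : ℝ) - 1 - 2 * α) / (1 + r ^ 2) := by
    have : r ^ (d - 1) = r ^ ((d : ℝ) - 1) := by
      rw [← Real.rpow_natCast, Nat.cast_sub (by lia), Nat.cast_one]
    rw [decayKernel, this, ← Real.rpow_natCast r 2, ← Real.rpow_mul hr.le, Nat.cast_ofNat,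
      mul_div_assoc', ← Real.rpow_add hr, Real.rpow_ofNat]
    ring_nf
  have hm : Measurable fun r : ℝ => r ^ (d - 1) * decayKernel α (r ^ 2) := by
    unfold decayKernel; fun_prop
  rw [← Set.Ioc_union_Ioi_eq_Ioi zero_le_one]
  refine IntegrableOn.union ?_ ?_
  · have : IntegrableOn (fun r : ℝ => r ^ ((d : ℝ) - 1 - 2 * α)) (Set.Ioc 0 1) :=
      (intervalIntegrable_iff_integrableOn_Ioc_of_le zero_le_one).1
        (intervalIntegral.intervalIntegrable_rpow' (by linarith))
    refine this.mono' hm.aestronglyMeasurable ?_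
    filter_upwards [self_mem_ae_restrict measurableSet_Ioc] with r hr
    have hr0 : 0 < r := hr.1
    rw [e r hr0, Real.norm_of_nonneg (by positivity)]
    exact div_le_self (by positivity) (by nlinarith)
  · have : IntegrableOn (fun r : ℝ => r ^ ((d : ℝ) - 1 - 2 * α - 2)) (Set.Ioi 1) :=
      integrableOn_Ioi_rpow_of_lt (by linarith) zero_lt_one
    refine this.mono' hm.aestronglyMeasurable ?_
    filter_upwards [self_mem_ae_restrict measurableSet_Ioi] with r hr
    have hr0 : 0 < r := zero_lt_one.trans hr
    rw [e r hr0, Real.norm_of_nonneg (by positivity), Real.rpow_sub hr0 _ 2, Real.rpow_ofNat]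
    gcongr
    linarith

lemma measurable_incrementKernel (α τ : ℝ) : Measurable (incrementKernel α τ) := by
  unfold incrementKernel; fun_prop

lemma integrableOn_expSecondDiff_mul_rpow {τ s : ℝ} (hτ : 0 ≤ τ) (h0 : 0 < s) (h1 : s < 1) :
    IntegrableOn (fun u => expSecondDiff τ 0 u * u ^ (-s - 1)) (Set.Ioi 0) := by
  have hm : Measurable fun u => expSecondDiff τ 0 u * u ^ (-s - 1) := by
    unfold expSecondDiff; fun_prop
  rw [← Set.Ioc_union_Ioi_eq_Ioi zero_le_one]
  refine IntegrableOn.union ?_ ?_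
  · have : IntegrableOn (fun r : ℝ => r ^ (-s)) (Set.Ioc 0 1) :=
      (intervalIntegrable_iff_integrableOn_Ioc_of_le zero_le_one).1
        (intervalIntegral.intervalIntegrable_rpow' (by linarith))
    refine this.mono' hm.aestronglyMeasurable ?_
    filter_upwards [self_mem_ae_restrict measurableSet_Ioc] with r hr
    have hr0 : 0 < r := hr.1
    have := expSecondDiff_zero_nonneg τ r
    rw [Real.norm_of_nonneg (by positivity), Real.rpow_sub_one hr0.ne']
    calc _ ≤ r * (r ^ (-s) / r) := by
          gcongr; exact (expSecondDiff_zero_le hτ hr0.le).2.1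
      _ = _ := by field_simp
  · have : IntegrableOn (fun r : ℝ => r ^ (-s - 1)) (Set.Ioi 1) :=
      integrableOn_Ioi_rpow_of_lt (by linarith) zero_lt_one
    refine this.mono' hm.aestronglyMeasurable ?_
    filter_upwards [self_mem_ae_restrict measurableSet_Ioi] with r hr
    have hr0 : 0 < r := zero_lt_one.trans hr
    have := expSecondDiff_zero_nonneg τ r
    rw [Real.norm_of_nonneg (by positivity)]
    exact mul_le_of_le_one_left (by positivity) (expSecondDiff_zero_le hτ hr0.le).1

lemma integral_mul_exp_mul_rpow {b s : ℝ} (hb : 0 ≤ b) (h0 : 0 < s) (h1 : s < 1) :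
    IntegrableOn (fun u => b * Real.exp (-(b * u)) * u ^ (-s)) (Set.Ioi 0) ∧
    ∫ u in Set.Ioi (0 : ℝ), b * Real.exp (-(b * u)) * u ^ (-s) = b ^ s * Real.Gamma (1 - s) := by
  rcases hb.eq_or_lt with rfl | hb
  · simp [Real.zero_rpow h0.ne']
  have e (u : ℝ) : b * Real.exp (-(b * u)) * u ^ (-s)
      = b * (u ^ ((1 - s) - 1) * Real.exp (-(b * u))) := by
    rw [sub_sub_cancel_left]; ring
  simp only [e]
  constructor
  · have := (integrableOn_rpow_mul_exp_neg_mul_rpow (p := 1) (s := -s) (b := b) (by linarith)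
      one_pos hb).const_mul b
    simpa [IntegrableOn] using this
  · rw [integral_const_mul, Real.integral_rpow_mul_exp_neg_mul_Ioi (by linarith) hb,
      Real.div_rpow zero_le_one hb.le, Real.one_rpow, Real.rpow_sub hb, Real.rpow_one]
    have := Real.rpow_pos_of_pos hb s
    field_simp

lemma integral_expSecondDiff_mul_rpow {τ s : ℝ} (hτ : 0 ≤ τ) (h0 : 0 < s) (h1 : s < 1) :
    ∫ u in Set.Ioi (0 : ℝ), expSecondDiff τ 0 u * u ^ (-s - 1) =
      (2 * (τ + 1) ^ s - τ ^ s - (τ + 2) ^ s) * (Real.Gamma (1 - s) / s) := by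
  obtain ⟨i0, v0⟩ := integral_mul_exp_mul_rpow hτ h0 h1
  obtain ⟨i1, v1⟩ := integral_mul_exp_mul_rpow (by linarith : 0 ≤ τ + 1) h0 h1
  obtain ⟨i2, v2⟩ := integral_mul_exp_mul_rpow (by linarith : 0 ≤ τ + 2) h0 h1
  have e (u : ℝ) : -expSecondDiff τ (0 + 1) u * u ^ (-s)
      = 2 * ((τ + 1) * Real.exp (-((τ + 1) * u)) * u ^ (-s))
        - τ * Real.exp (-(τ * u)) * u ^ (-s) - (τ + 2) * Real.exp (-((τ + 2) * u)) * u ^ (-s) := by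
    rw [expSecondDiff]; ring
  have hi1 : IntegrableOn (fun u => -expSecondDiff τ (0 + 1) u * u ^ (-s)) (Set.Ioi 0) := by
    simp only [e]
    exact ((i1.const_mul 2).sub i0).sub i2
  have hv : ∫ u in Set.Ioi (0 : ℝ), -expSecondDiff τ (0 + 1) u * u ^ (-s)
      = (2 * (τ + 1) ^ s - τ ^ s - (τ + 2) ^ s) * Real.Gamma (1 - s) := by
    simp only [e]
    have i3 : IntegrableOn (fun u => 2 * ((τ + 1) * Real.exp (-((τ + 1) * u)) * u ^ (-s))
        - τ * Real.exp (-(τ * u)) * u ^ (-s)) (Set.Ioi 0) := (i1.const_mul 2).sub i0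
    rw [integral_sub i3 i2, integral_sub (i1.const_mul 2) i0,
      integral_const_mul, v0, v1, v2]
    ring
  have hz : Filter.Tendsto (expSecondDiff τ 0 * fun u => u ^ (-s)) (nhdsWithin 0 (Set.Ioi 0))
      (nhds 0) := by
    have : Filter.Tendsto (fun u : ℝ => u ^ (1 - s)) (nhdsWithin 0 (Set.Ioi 0)) (nhds 0) := by
      have := (Real.continuousAt_rpow_const 0 (1 - s) (Or.inr (by linarith))).tendsto
      rw [Real.zero_rpow (by linarith)] at this
      exact this.mono_left nhdsWithin_le_nhds
    refine squeeze_zero' ?_ ?_ this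
    · filter_upwards [self_mem_nhdsWithin] with u hu
      have hu : 0 < u := hu
      have := expSecondDiff_zero_nonneg τ u
      simp only [Pi.mul_apply]
      positivity
    · filter_upwards [self_mem_nhdsWithin] with u hu
      have hu : 0 < u := hu
      rw [sub_eq_add_neg, Real.rpow_add hu, Real.rpow_one]
      exact mul_le_mul_of_nonneg_right (expSecondDiff_zero_le hτ hu.le).2.1 (by positivity)
  have hinf : Filter.Tendsto (expSecondDiff τ 0 * fun u => u ^ (-s)) Filter.atTop (nhds 0) := by
    refine squeeze_zero' ?_ ?_ (tendsto_rpow_neg_atTop h0)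
    · filter_upwards [Filter.eventually_gt_atTop 0] with u hu
      have := expSecondDiff_zero_nonneg τ u
      simp only [Pi.mul_apply]
      positivity
    · filter_upwards [Filter.eventually_gt_atTop 0] with u hu
      exact mul_le_of_le_one_left (by positivity) (expSecondDiff_zero_le hτ hu.le).1
  have hint := (integrableOn_expSecondDiff_mul_rpow hτ h0 h1).const_mul (-s)
  have key := integral_Ioi_mul_deriv_eq_deriv_mul (a := 0) (u := expSecondDiff τ 0)
    (v := fun u => u ^ (-s)) (u' := fun u => -expSecondDiff τ (0 + 1) u)
    (v' := fun u => -s * u ^ (-s - 1)) (fun x _ => hasDerivAt_expSecondDiff τ 0 x)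
    (fun x hx => Real.hasDerivAt_rpow_const (Or.inl (ne_of_gt hx)))
    (hint.congr (Filter.Eventually.of_forall fun u => by simp only [Pi.mul_apply]; ring))
    hi1 hz hinf
  rw [hv] at key
  have e2 (u : ℝ) : expSecondDiff τ 0 u * (-s * u ^ (-s - 1))
    = -s * (expSecondDiff τ 0 u * u ^ (-s - 1)) := by ring
  simp only [e2] at key
  rw [integral_const_mul] at key
  field_simp
  linarith

lemma integral_incrementKernel_orthant {d : ℕ} (hd : d ≠ 0) {η s α τ : ℝ} (hη : 0 < η)
    (h0 : 0 < s) (h1 : s < 1) (hα : α = (d : ℝ) / 2 - 1 + s) (hτ : 0 ≤ τ) :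
    ∫ z in Set.univ.pi fun _ : Fin d => Set.Ici (0 : ℝ),
        incrementKernel α τ (Real.pi ^ 2 * η * ∑ i, z i ^ 2) =
      1 / 2 * (2 * (τ + 1) ^ s - τ ^ s - (τ + 2) ^ s) *
        (Real.Gamma (1 - s) /
          (2 ^ d * (Real.pi * η) ^ ((d : ℝ) / 2) * s * Real.Gamma ((d : ℝ) / 2))) := by
  have ha : 0 < Real.pi ^ 2 * η := by positivity
  have hd0 : (0 : ℝ) < d := by positivity
  rw [integral_sum_sq_orthant (φ := fun x => incrementKernel α τ (Real.pi ^ 2 * η * x))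
    ((measurable_incrementKernel α τ).comp (by fun_prop)),
    integral_sum_sq hd (fun x => incrementKernel α τ (Real.pi ^ 2 * η * x))]
  have hrad : ∫ r in Set.Ioi (0 : ℝ),
      r ^ (d - 1) * incrementKernel α τ (Real.pi ^ 2 * η * r ^ 2)
      = 1 / 4 * (Real.pi ^ 2 * η) ^ (-((d : ℝ) / 2)) *
        ∫ u in Set.Ioi (0 : ℝ), expSecondDiff τ 0 u * u ^ (-s - 1) := by
    have hcov := integral_comp_mul_left_Ioi
      (fun u => expSecondDiff τ 0 u * u ^ (-s - 1)) 0 ha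
    have hpow := integral_comp_rpow_Ioi_of_pos (p := 2) (by norm_num)
      (g := fun v => (fun u => expSecondDiff τ 0 u * u ^ (-s - 1)) (Real.pi ^ 2 * η * v))
    rw [hcov, mul_zero, smul_eq_mul] at hpow
    have : ∫ u in Set.Ioi (0 : ℝ), expSecondDiff τ 0 u * u ^ (-s - 1)
        = Real.pi ^ 2 * η * ∫ x in Set.Ioi (0 : ℝ), (2 * x ^ ((2 : ℝ) - 1)) •
          (expSecondDiff τ 0 (Real.pi ^ 2 * η * x ^ (2 : ℝ)) *
            (Real.pi ^ 2 * η * x ^ (2 : ℝ)) ^ (-s - 1)) := by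
      rw [hpow]; field_simp
    rw [this, ← integral_const_mul, ← integral_const_mul]
    refine setIntegral_congr_fun measurableSet_Ioi fun r hr => ?_
    have hr : 0 < r := hr
    have hr1 : r ^ (d - 1) = r ^ ((d : ℝ) - 1) := by
      rw [← Real.rpow_natCast, Nat.cast_sub (by lia), Nat.cast_one]
    simp only [smul_eq_mul, Real.rpow_ofNat]
    rw [incrementKernel_eq (by positivity), hr1, hα, Real.mul_rpow ha.le (by positivity),
      Real.mul_rpow ha.le (by positivity), ← Real.rpow_natCast r 2, ← Real.rpow_mul hr.le,
      ← Real.rpow_mul hr.le]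
    have p1 : (Real.pi ^ 2 * η) ^ (-(1 + ((d : ℝ) / 2 - 1 + s)))
        = (Real.pi ^ 2 * η) ^ (-((d : ℝ) / 2)) * (Real.pi ^ 2 * η *
          (Real.pi ^ 2 * η) ^ (-s - 1)) := by
      rw [← Real.rpow_one_add' ha.le (by linarith), ← Real.rpow_add ha]; ring_nf
    have p2 : r ^ ((d : ℝ) - 1) * r ^ (((2 : ℕ) : ℝ) * (-(1 + ((d : ℝ) / 2 - 1 + s))))
        = r ^ ((2 : ℝ) - 1) * r ^ (((2 : ℕ) : ℝ) * (-s - 1)) := by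
      rw [← Real.rpow_add hr, ← Real.rpow_add hr]; push_cast; ring_nf
    rw [p1]
    linear_combination (expSecondDiff τ 0 (Real.pi ^ 2 * η * r ^ ((2 : ℕ) : ℝ)) / 2 *
      ((Real.pi ^ 2 * η) ^ (-((d : ℝ) / 2)) * (Real.pi ^ 2 * η *
          (Real.pi ^ 2 * η) ^ (-s - 1)))) * p2
  rw [hrad, integral_expSecondDiff_mul_rpow hτ h0 h1]
  have hG : Real.Gamma ((d : ℝ) / 2 + 1) = d / 2 * Real.Gamma ((d : ℝ) / 2) :=
    Real.Gamma_add_one (by positivity)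
  have hGp : 0 < Real.Gamma ((d : ℝ) / 2) := Real.Gamma_pos_of_pos (by positivity)
  have hs : √Real.pi ^ d = Real.pi ^ ((d : ℝ) / 2) := by
    rw [Real.sqrt_eq_rpow, ← Real.rpow_natCast, ← Real.rpow_mul Real.pi_pos.le]; ring_nf
  have hp : (Real.pi ^ 2 * η) ^ (-((d : ℝ) / 2))
      = (Real.pi ^ ((d : ℝ) / 2) * (Real.pi * η) ^ ((d : ℝ) / 2))⁻¹ := by
    rw [Real.rpow_neg ha.le, ← Real.mul_rpow (by positivity) (by positivity)]; ring_nf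
  rw [hG, hs, hp]
  have := Real.rpow_pos_of_pos Real.pi_pos ((d : ℝ) / 2)
  have := Real.rpow_pos_of_pos (by positivity : 0 < Real.pi * η) ((d : ℝ) / 2)
  field_simp
  ring

lemma exists_symmetric_taylor_bound {α τ a c ε δ : ℝ} (hα : 0 ≤ α) (hτ : 0 ≤ τ) (ha : 0 < a)
    (hε : 0 < ε) (hδ : 1 ≤ δ) :
    ∃ C > 0, ∀ D S U V : ℝ, 0 < D → δ * D ≤ S → 0 ≤ U → 4 * U ≤ δ * D → V ^ 2 ≤ S * U →
      ε * S ≤ c * D + a * S →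
      |incrementKernel α τ (c * D + a * S) - (incrementKernel α τ (a * (S + 2 * V + U))
        + incrementKernel α τ (a * (S - 2 * V + U))) / 2|
        ≤ C * D * decayKernel α (S + 2 * V + U) := by
  obtain ⟨g₁, g₂, C₁, hC₁, hg⟩ := exists_deriv_bounds_incrementKernel hα hτ
  obtain ⟨ρ, hρ0, hρε, hρa⟩ : ∃ ρ > 0, ρ ≤ ε ∧ ρ ≤ a / 4 :=
    ⟨min ε (a / 4), by positivity, min_le_left _ _, min_le_right _ _⟩
  obtain ⟨σ, hσ0, hσ1, hσρ⟩ : ∃ σ > 0, σ ≤ 1 ∧ σ ≤ 4 * ρ / 9 :=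
    ⟨min 1 (4 * ρ / 9), by positivity, min_le_left _ _, min_le_right _ _⟩
  set B := a * δ / 4 + |c| with hB
  have hB0 : 0 < B := by positivity
  refine ⟨C₁ * (B + (2 * a ^ 2 * δ + 2 * B ^ 2) / ρ) * (σ ^ (-α) / σ), by positivity, ?_⟩
  intro D S U V hD hDS hU hUD hV hx
  have hDS' : D ≤ S := by nlinarith
  have hS : 0 < S := hD.trans_le hDS'
  have hV' : |2 * V| ≤ 3 / 4 * S + U := by
    refine abs_le_of_sq_le_sq ?_ (by positivity)
    have : 0 ≤ (S - 4 * U) * (9 / 16 * S - U / 4) := mul_nonneg (by linarith) (by linarith)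
    nlinarith
  obtain ⟨hV1, hV2⟩ := abs_le.1 hV'
  set x := c * D + a * S with hxdef
  set m := ρ * S with hm
  have hm0 : 0 < m := by positivity
  have hmx : m ≤ x := (mul_le_mul_of_nonneg_right hρε hS.le).trans hx
  have hlow (Y : ℝ) (hY : S / 4 ≤ Y) : m ≤ a * Y :=
    calc m ≤ a / 4 * S := mul_le_mul_of_nonneg_right hρa hS.le
      _ = a * (S / 4) := by ring
      _ ≤ a * Y := by gcongr
  have hmp : m ≤ a * (S + 2 * V + U) := hlow _ (by linarith)
  have hmm : m ≤ a * (S - 2 * V + U) := hlow _ (by linarith)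
  have hWm := decayKernel_nonneg (α := α) hm0.le
  have hT (y : ℝ) (hy : m ≤ y) := abs_sub_sub_mul_le_of_deriv_bound (m := m)
    (K := C₁ * decayKernel α m / m)
    (fun z hz => (hg z (hm0.trans_le hz)).1) (fun z hz => (hg z (hm0.trans_le hz)).2.1)
    (fun z hz => (hg z (hm0.trans_le hz)).2.2.2.trans (by
      have := decayKernel_anti hα hm0 hz
      have := decayKernel_nonneg (α := α) (hm0.le.trans hz)
      gcongr)) hmx hy
  have hp := hT _ hmp
  have hn := hT _ hmm
  have hg1 : |g₁ x| ≤ C₁ * decayKernel α m :=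
    (hg x (hm0.trans_le hmx)).2.2.1.trans (by
      have := decayKernel_anti hα hm0 hmx
      gcongr)
  have hlin : |a * U - c * D| ≤ B * D := by
    refine (abs_sub _ _).trans ?_
    rw [abs_of_nonneg (by positivity), abs_mul, abs_of_pos hD, hB]
    nlinarith
  have hsq : (a * U - c * D) ^ 2 ≤ B ^ 2 * D * S := by
    calc (a * U - c * D) ^ 2 = |a * U - c * D| ^ 2 := (sq_abs _).symm
      _ ≤ (B * D) ^ 2 := by gcongr
      _ = B ^ 2 * D * D := by ring
      _ ≤ B ^ 2 * D * S := by gcongr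
  have hVD : a ^ 2 * (4 * V ^ 2) ≤ a ^ 2 * (δ * D * S) := by
    refine mul_le_mul_of_nonneg_left ?_ (by positivity)
    nlinarith
  have hquad (e : ℝ) (he : e ^ 2 = 4 * a ^ 2 * V ^ 2) :
      (e + (a * U - c * D)) ^ 2 ≤ (2 * a ^ 2 * δ + 2 * B ^ 2) * D * S := by
    calc (e + (a * U - c * D)) ^ 2 ≤ 2 * (e ^ 2 + (a * U - c * D) ^ 2) := add_sq_le
      _ ≤ 2 * (a ^ 2 * (δ * D * S) + B ^ 2 * D * S) := by rw [he]; linarith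
      _ = _ := by ring
  have hqp : (a * (S + 2 * V + U) - x) ^ 2 ≤ (2 * a ^ 2 * δ + 2 * B ^ 2) * D * S := by
    have : a * (S + 2 * V + U) - x = 2 * a * V + (a * U - c * D) := by rw [hxdef]; ring
    rw [this]
    exact hquad _ (by ring)
  have hqm : (a * (S - 2 * V + U) - x) ^ 2 ≤ (2 * a ^ 2 * δ + 2 * B ^ 2) * D * S := by
    have : a * (S - 2 * V + U) - x = -(2 * a * V) + (a * U - c * D) := by rw [hxdef]; ring
    rw [this]
    exact hquad _ (by ring)
  have hK : C₁ * decayKernel α m / m * ((2 * a ^ 2 * δ + 2 * B ^ 2) * D * S)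
      = C₁ * decayKernel α m * D * ((2 * a ^ 2 * δ + 2 * B ^ 2) / ρ) := by
    rw [hm]; field_simp
  have hKn : 0 ≤ C₁ * decayKernel α m / m := by positivity
  replace hp := hp.trans (mul_le_mul_of_nonneg_left hqp hKn)
  replace hn := hn.trans (mul_le_mul_of_nonneg_left hqm hKn)
  rw [hK] at hp hn
  have hl : |g₁ x * (a * U - c * D)| ≤ C₁ * decayKernel α m * (B * D) := by
    rw [abs_mul]; gcongr
  have hfin : |incrementKernel α τ x - (incrementKernel α τ (a * (S + 2 * V + U))
        + incrementKernel α τ (a * (S - 2 * V + U))) / 2|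
      ≤ C₁ * (B + (2 * a ^ 2 * δ + 2 * B ^ 2) / ρ) * D * decayKernel α m := by
    have hmid : g₁ x * (a * (S + 2 * V + U) - x) + g₁ x * (a * (S - 2 * V + U) - x)
        = 2 * (g₁ x * (a * U - c * D)) := by rw [hxdef]; ring
    have hrhs : C₁ * (B + (2 * a ^ 2 * δ + 2 * B ^ 2) / ρ) * D * decayKernel α m
        = C₁ * decayKernel α m * (B * D)
          + C₁ * decayKernel α m * D * ((2 * a ^ 2 * δ + 2 * B ^ 2) / ρ) := by ring
    rw [hrhs]
    generalize C₁ * decayKernel α m * D * ((2 * a ^ 2 * δ + 2 * B ^ 2) / ρ) = R at *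
    rw [abs_le] at hp hn hl ⊢
    constructor <;> linarith
  have hW : decayKernel α m ≤ σ ^ (-α) / σ * decayKernel α (S + 2 * V + U) := by
    have hY : 0 < S + 2 * V + U := by linarith
    refine (decayKernel_anti hα (by positivity) ?_).trans (decayKernel_mul_le hσ0 hσ1 hY)
    calc σ * (S + 2 * V + U) ≤ 4 * ρ / 9 * (9 / 4 * S) := by
          gcongr
          linarith
      _ = m := by rw [hm]; ring
  calc _ ≤ _ := hfin
    _ ≤ C₁ * (B + (2 * a ^ 2 * δ + 2 * B ^ 2) / ρ) * D
        * (σ ^ (-α) / σ * decayKernel α (S + 2 * V + U)) := by gcongr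
    _ = _ := by ring

lemma exists_midpoint_bound {d : ℕ} (hd : d ≠ 0) {α τ a c : ℝ} (hα : 0 ≤ α) (hτ : 0 ≤ τ)
    (ha : 0 < a) (hc : 0 < c + a * d) :
    ∃ C > 0, ∀ h > 0, ∀ k : Fin d → ℕ+, ∀ y : Fin d → ℝ, (∀ i, |y i - h * (k i : ℕ)| ≤ h / 2) →
      |incrementKernel α τ ((c + a * ∑ i, ((k i : ℕ) : ℝ) ^ 2) * h ^ 2)
        - (incrementKernel α τ (a * ∑ i, y i ^ 2)
          + incrementKernel α τ (a * ∑ i, (2 * (h * (k i : ℕ)) - y i) ^ 2)) / 2|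
        ≤ C * h ^ 2 * decayKernel α (∑ i, y i ^ 2) := by
  have hd1 : (1 : ℝ) ≤ d := by exact_mod_cast Nat.one_le_iff_ne_zero.2 hd
  obtain ⟨ε, hε0, hεa, hεc⟩ : ∃ ε > 0, ε ≤ a ∧ ε ≤ (c + a * d) / d :=
    ⟨min a ((c + a * d) / d), by positivity, min_le_left _ _, min_le_right _ _⟩
  obtain ⟨C, hC, hb⟩ := exists_symmetric_taylor_bound (c := c) hα hτ ha hε0 hd1
  refine ⟨C, hC, fun h hh k y hy => ?_⟩
  set T := ∑ i, ((k i : ℕ) : ℝ) ^ 2 with hT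
  have hTd : (d : ℝ) ≤ T := by
    have : ∑ _i : Fin d, (1 : ℝ) ≤ T := Finset.sum_le_sum fun i _ =>
      one_le_pow₀ (by exact_mod_cast (k i).pos)
    simpa using this
  have hεT : ε * T ≤ c + a * T := by
    rw [le_div_iff₀ (by linarith)] at hεc
    nlinarith
  set z : Fin d → ℝ := fun i => h * (k i : ℕ) with hz
  have hSz : ∑ i, z i ^ 2 = h ^ 2 * T := by simp [hz, mul_pow, Finset.mul_sum, hT]
  have e1 : ∑ i, y i ^ 2 = ∑ i, z i ^ 2 + 2 * ∑ i, z i * (y i - z i) + ∑ i, (y i - z i) ^ 2 := by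
    rw [Finset.mul_sum, ← Finset.sum_add_distrib, ← Finset.sum_add_distrib]
    exact Finset.sum_congr rfl fun i _ => by ring
  have e2 : ∑ i, (2 * (h * (k i : ℕ)) - y i) ^ 2
      = ∑ i, z i ^ 2 - 2 * ∑ i, z i * (y i - z i) + ∑ i, (y i - z i) ^ 2 := by
    rw [Finset.mul_sum, ← Finset.sum_sub_distrib, ← Finset.sum_add_distrib]
    exact Finset.sum_congr rfl fun i _ => by simp only [hz]; ring
  have e3 : (c + a * T) * h ^ 2 = c * h ^ 2 + a * ∑ i, z i ^ 2 := by rw [hSz]; ring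
  rw [e1, e2, e3]
  have hh2 : 0 < h ^ 2 := by positivity
  refine hb (h ^ 2) _ _ _ hh2 (by rw [hSz]; nlinarith) (by positivity) ?_
    (Finset.sum_mul_sq_le_sq_mul_sq _ _ _) (by rw [hSz]; nlinarith)
  have : ∑ i, (y i - z i) ^ 2 ≤ ∑ _i : Fin d, (h / 2) ^ 2 := Finset.sum_le_sum fun i _ => by
    rw [← sq_abs]; exact pow_le_pow_left₀ (abs_nonneg _) (hy i) 2
  simp only [Finset.sum_const, Finset.card_univ, Fintype.card_fin, nsmul_eq_mul] at this
  linarith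

lemma setIntegral_Icc_reflect {d : ℕ} (a b : Fin d → ℝ) (G : (Fin d → ℝ) → ℝ) :
    ∫ y in Set.Icc a b, G (a + b - y) = ∫ y in Set.Icc a b, G y := by
  rw [← integral_indicator measurableSet_Icc, ← integral_indicator measurableSet_Icc,
    ← integral_sub_left_eq_self _ volume (a + b)]
  congr 1 with y
  have : a + b - y ∈ Set.Icc a b ↔ y ∈ Set.Icc a b := by
    rw [← Set.mem_preimage (f := fun y => a + b - y), Set.preimage_const_sub_Icc]
    simp
  by_cases hy : y ∈ Set.Icc a b
  · rw [Set.indicator_of_mem (this.2 hy), Set.indicator_of_mem hy, sub_sub_cancel]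
  · rw [Set.indicator_of_notMem (mt this.1 hy), Set.indicator_of_notMem hy]

/-- The half-open cube of side `h` centred at `h • k`. -/
def gridCell {d : ℕ} (h : ℝ) (k : Fin d → ℕ+) : Set (Fin d → ℝ) :=
  Set.univ.pi fun i => Set.Ico (h * (k i : ℕ) - h / 2) (h * (k i : ℕ) + h / 2)

lemma measurableSet_gridCell {d : ℕ} (h : ℝ) (k : Fin d → ℕ+) : MeasurableSet (gridCell h k) :=
  MeasurableSet.univ_pi fun _ => measurableSet_Ico

lemma gridCell_ae_eq_Icc {d : ℕ} (h : ℝ) (k : Fin d → ℕ+) :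
    gridCell h k =ᵐ[volume]
      Set.Icc (fun i => h * (k i : ℕ) - h / 2) (fun i => h * (k i : ℕ) + h / 2) :=
  Measure.univ_pi_Ico_ae_eq_Icc

lemma pairwise_disjoint_gridCell {d : ℕ} {h : ℝ} (hh : 0 < h) :
    Pairwise (Function.onFun Disjoint (gridCell (d := d) h)) := by
  intro k l hkl
  refine Set.disjoint_left.2 fun x hx hy => hkl ?_
  funext i
  obtain ⟨h1, h2⟩ := hx i trivial
  obtain ⟨h3, h4⟩ := hy i trivial
  have a1 : ((k i : ℕ) : ℝ) < (l i : ℕ) + 1 := lt_of_mul_lt_mul_left (by linarith) hh.le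
  have a2 : ((l i : ℕ) : ℝ) < (k i : ℕ) + 1 := lt_of_mul_lt_mul_left (by linarith) hh.le
  rw [← Nat.cast_add_one, Nat.cast_lt] at a1 a2
  exact PNat.eq (by lia)

lemma iUnion_gridCell {d : ℕ} {h : ℝ} (hh : 0 < h) :
    ⋃ k, gridCell (d := d) h k = {x | ∀ i, h / 2 ≤ x i} := by
  ext x
  simp only [Set.mem_iUnion, Set.mem_ofPred_eq]
  constructor
  · rintro ⟨k, hk⟩ i
    have h1 := (hk i trivial).1
    have : (1 : ℝ) ≤ (k i : ℕ) := by exact_mod_cast (k i).pos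
    nlinarith
  · intro hx
    have hx' (i : Fin d) : 1 ≤ x i / h + 1 / 2 := by
      have : 1 / 2 ≤ x i / h := by rw [le_div_iff₀ hh]; linarith [hx i]
      linarith
    have hfl (i : Fin d) : 0 < ⌊x i / h + 1 / 2⌋₊ := Nat.floor_pos.2 (hx' i)
    refine ⟨fun i => ⟨⌊x i / h + 1 / 2⌋₊, hfl i⟩, fun i _ => ?_⟩
    have h1 := Nat.floor_le (zero_le_one.trans (hx' i))
    have h2 := Nat.lt_floor_add_one (x i / h + 1 / 2)
    have e : x i = h * (x i / h) := by field_simp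
    simp only [PNat.mk_coe, Set.mem_Ico]
    constructor <;> nlinarith

lemma summable_and_abs_tsum_sub_integral_le {d : ℕ} {h K : ℝ} (hh : 0 < h) (hK : 0 ≤ K)
    {G F : (Fin d → ℝ) → ℝ} (hG : Integrable G) (hF : Integrable F) (hF0 : ∀ y, 0 ≤ F y)
    {A : (Fin d → ℕ+) → ℝ}
    (hA : ∀ k, ∀ y : Fin d → ℝ, (∀ i, |y i - h * (k i : ℕ)| ≤ h / 2) →
      |A k - (G y + G fun i => 2 * (h * (k i : ℕ)) - y i) / 2| ≤ K * F y) :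
    Summable A ∧ |h ^ d * ∑' k, A k - ∫ y in {x | ∀ i, h / 2 ≤ x i}, G y| ≤ K * ∫ y, F y := by
  have hsumG := hasSum_integral_iUnion (measurableSet_gridCell h)
    (pairwise_disjoint_gridCell (d := d) hh) hG.integrableOn
  have hsumF := hasSum_integral_iUnion (measurableSet_gridCell h)
    (pairwise_disjoint_gridCell (d := d) hh) hF.integrableOn
  rw [iUnion_gridCell hh] at hsumG hsumF
  have hcell (k : Fin d → ℕ+) :
      |h ^ d * A k - ∫ y in gridCell h k, G y| ≤ K * ∫ y in gridCell h k, F y := by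
    rw [setIntegral_congr_set (gridCell_ae_eq_Icc h k),
      setIntegral_congr_set (gridCell_ae_eq_Icc h k)]
    set a : Fin d → ℝ := fun i => h * (k i : ℕ) - h / 2 with ha
    set b : Fin d → ℝ := fun i => h * (k i : ℕ) + h / 2 with hb
    have hab : a ≤ b := fun i => by simp only [ha, hb]; linarith
    have hvol : (volume (Set.Icc a b)).toReal = h ^ d := by
      rw [Real.volume_Icc_pi_toReal hab]
      simp [ha, hb, ← sub_add]
    have hfin : volume (Set.Icc a b) ≠ ⊤ := isCompact_Icc.measure_lt_top.ne
    have hrefl := setIntegral_Icc_reflect a b G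
    have hGr : Integrable fun y => G (a + b - y) := hG.comp_sub_left (a + b)
    have hconst : IntegrableOn (fun _ => A k) (Set.Icc a b) := integrableOn_const hfin
    have havg : IntegrableOn (fun y => (G y + G (a + b - y)) / 2) (Set.Icc a b) :=
      ((hG.add hGr).div_const 2).integrableOn
    have heq : h ^ d * A k - ∫ y in Set.Icc a b, G y
        = ∫ y in Set.Icc a b, (A k - (G y + G (a + b - y)) / 2) := by
      rw [integral_sub hconst havg, integral_div, integral_add hG.integrableOn hGr.integrableOn,
        hrefl, setIntegral_const, Measure.real, hvol, smul_eq_mul]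
      ring
    rw [heq, ← integral_const_mul, ← Real.norm_eq_abs]
    refine norm_integral_le_of_norm_le (hF.integrableOn.const_mul K) ?_
    filter_upwards [self_mem_ae_restrict measurableSet_Icc] with y hy
    have e : a + b - y = fun i => 2 * (h * (k i : ℕ)) - y i := by
      funext i; simp only [ha, hb, Pi.add_apply, Pi.sub_apply]; ring
    rw [e]
    refine hA k y fun i => abs_le.2 ⟨?_, ?_⟩
    · have := hy.1 i; simp only [ha] at this; linarith
    · have := hy.2 i; simp only [hb] at this; linarith
  have hsumE : Summable fun k => h ^ d * A k - ∫ y in gridCell h k, G y :=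
    Summable.of_norm_bounded (hsumF.summable.mul_left K) hcell
  have hsumA : Summable fun k => h ^ d * A k := by
    simpa using hsumE.add hsumG.summable
  refine ⟨(summable_mul_left_iff (by positivity)).1 hsumA, ?_⟩
  rw [← tsum_mul_left, ← hsumG.tsum_eq, ← hsumA.tsum_sub hsumG.summable]
  calc _ ≤ ∑' k, K * ∫ y in gridCell h k, F y := by
        rw [← Real.norm_eq_abs]
        exact tsum_of_norm_bounded (hsumF.summable.mul_left K).hasSum hcell
    _ = K * ∫ y in {x | ∀ i, h / 2 ≤ x i}, F y := by rw [tsum_mul_left, hsumF.tsum_eq]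
    _ ≤ K * ∫ y, F y := by
        exact mul_le_mul_of_nonneg_left
          (setIntegral_le_integral hF (Filter.Eventually.of_forall hF0)) hK

/-- The part of the orthant where exactly the coordinates marked by `γ` are below `r`. -/
def orthantPart {d : ℕ} (r : ℝ) (γ : Fin d → Bool) : Set (Fin d → ℝ) :=
  {x | ∀ i, (γ i = true → 0 ≤ x i ∧ x i < r) ∧ (γ i = false → r ≤ x i)}

lemma orthantPart_eq_pi {d : ℕ} (r : ℝ) (γ : Fin d → Bool) :
    orthantPart r γ = Set.univ.pi fun i => if γ i then Set.Ico 0 r else Set.Ici r := by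
  ext x
  simp only [orthantPart, Set.mem_ofPred_eq, Set.mem_univ_pi]
  refine forall_congr' fun i => ?_
  cases γ i <;> simp

lemma measurableSet_orthantPart {d : ℕ} (r : ℝ) (γ : Fin d → Bool) :
    MeasurableSet (orthantPart r γ) := by
  rw [orthantPart_eq_pi]
  refine MeasurableSet.univ_pi fun i => ?_
  split_ifs <;> measurability

lemma pairwise_disjoint_orthantPart {d : ℕ} (r : ℝ) :
    Pairwise (Function.onFun Disjoint (orthantPart (d := d) r)) := by
  intro γ δ hne
  refine Set.disjoint_left.2 fun x hx hy => hne ?_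
  funext i
  have h1 := hx i
  have h2 := hy i
  cases hγ : γ i <;> cases hδ : δ i <;> simp_all
  all_goals linarith

lemma iUnion_orthantPart {d : ℕ} {r : ℝ} (hr : 0 ≤ r) :
    ⋃ γ, orthantPart (d := d) r γ = Set.univ.pi fun _ => Set.Ici 0 := by
  ext x
  simp only [Set.mem_iUnion, Set.mem_univ_pi, Set.mem_Ici]
  constructor
  · rintro ⟨γ, hγ⟩ i
    rcases h : γ i with _ | _
    · exact hr.trans ((hγ i).2 h)
    · exact ((hγ i).1 h).1
  · intro hx
    refine ⟨fun i => decide (x i < r), fun i => ⟨fun h => ⟨hx i, by simpa using h⟩, fun h => ?_⟩⟩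
    simpa using h

lemma integral_orthant_eq {d : ℕ} (hd : d ≠ 0) {r : ℝ} (hr : 0 ≤ r) {G : (Fin d → ℝ) → ℝ}
    (hG : Integrable G) :
    ∫ z in Set.univ.pi fun _ => Set.Ici (0 : ℝ), G z =
      (∫ z in {x | ∀ i, r ≤ x i}, G z) + (∫ z in orthantPart r fun _ => true, G z)
      + ∑ γ ∈ Finset.univ.filter (fun γ : Fin d → Bool =>
          1 ≤ (Finset.univ.filter fun i => γ i = true).card ∧
            (Finset.univ.filter fun i => γ i = true).card ≤ d - 1),
          ∫ z in orthantPart r γ, G z := by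
  rw [← iUnion_orthantPart hr, integral_iUnion_fintype (measurableSet_orthantPart r)
    (pairwise_disjoint_orthantPart r) fun _ => hG.integrableOn,
    ← Finset.sum_filter_add_sum_filter_not _ (fun γ : Fin d → Bool =>
          1 ≤ (Finset.univ.filter fun i => γ i = true).card ∧
            (Finset.univ.filter fun i => γ i = true).card ≤ d - 1), add_comm]
  congr 1
  have hne : (fun _ : Fin d => false) ≠ fun _ => true := fun h => by
    simpa using congrFun h ⟨0, Nat.pos_of_ne_zero hd⟩
  have hfilter : (Finset.univ.filter (fun γ : Fin d → Bool =>
      ¬(1 ≤ (Finset.univ.filter fun i => γ i = true).card ∧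
        (Finset.univ.filter fun i => γ i = true).card ≤ d - 1)))
      = {fun _ => false, fun _ => true} := by
    ext γ
    simp only [Finset.mem_filter, Finset.mem_univ, true_and, Finset.mem_insert,
      Finset.mem_singleton]
    have hle := Finset.card_filter_le (Finset.univ : Finset (Fin d)) fun i => γ i = true
    rw [Finset.card_univ, Fintype.card_fin] at hle
    have h0 : (Finset.univ.filter fun i => γ i = true).card = 0 ↔ γ = fun _ => false := by
      simp [Finset.filter_eq_empty_iff, funext_iff]
    have h1 : (Finset.univ.filter fun i => γ i = true).card = d ↔ γ = fun _ => true := by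
      have := Finset.card_filter_eq_iff (s := (Finset.univ : Finset (Fin d)))
        (p := fun i => γ i = true)
      rw [Finset.card_univ, Fintype.card_fin] at this
      simp [this, funext_iff]
    rw [← h0, ← h1]
    lia
  rw [hfilter, Finset.sum_pair hne]
  congr 3
  ext x
  simp [orthantPart]

lemma exists_incrementKernel_mul_le {α τ a : ℝ} (hα : 0 ≤ α) (hτ : 0 ≤ τ) (ha : 0 < a) :
    ∃ M > 0, ∀ S ≥ 0, incrementKernel α τ (a * S) ≤ M * decayKernel α S ∧
      incrementKernel α τ (a * S) ≤ M * S * decayKernel α S := by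
  obtain ⟨ρ, hρ0, hρ1, hρa⟩ : ∃ ρ > 0, ρ ≤ 1 ∧ ρ ≤ a :=
    ⟨min 1 a, by positivity, min_le_left _ _, min_le_right _ _⟩
  refine ⟨(1 + a) * (ρ ^ (-α) / ρ), by positivity, fun S hS => ?_⟩
  rcases hS.lt_or_eq with hS | rfl
  · have hW := decayKernel_nonneg (α := α) hS.le
    have hP : 0 < ρ ^ (-α) / ρ := by positivity
    have h1 : decayKernel α (a * S) ≤ ρ ^ (-α) / ρ * decayKernel α S :=
      (decayKernel_anti hα (by positivity) (by gcongr)).trans (decayKernel_mul_le hρ0 hρ1 hS)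
    obtain ⟨h2, h3⟩ := incrementKernel_le (α := α) hτ (mul_pos ha hS)
    have h4 : 0 ≤ ρ ^ (-α) / ρ * decayKernel α S := by positivity
    constructor
    · nlinarith
    · calc _ ≤ a * S * decayKernel α (a * S) := h3
        _ ≤ (1 + a) * S * (ρ ^ (-α) / ρ * decayKernel α S) := by
            gcongr
            · exact decayKernel_nonneg (by positivity)
            · linarith
        _ = _ := by ring
  · have h0 : incrementKernel α τ (a * 0) = 0 := by simp [incrementKernel]
    have := decayKernel_nonneg (α := α) le_rfl
    rw [h0]
    constructor <;> positivity

/-- for `g_{α,τ}(x) = (1−e^{−x})² e^{−τx}/(2x^{1+α})` with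
`α = d/2 − 1 + α'`, `α' ∈ (0,1)`, `τ ≥ 0`, one has, for all sufficiently small `Δ > 0`,
`|Δ^{d/2} Σ_{k} g_{α,τ}(λ_k Δ) − (1/2)(2(τ+1)^{α'} − τ^{α'} − (τ+2)^{α'})·
  Γ(1−α')/(2^d (πη)^{d/2} α' Γ(d/2)) + Σ_{γ, 1 ≤ ‖γ‖₁ ≤ d−1} ∫_{B_γ(Δ)} g_{α,τ}(π²η‖z‖²) dz|
  ≤ C Δ^{1−α'}` (with `0^{α'} = 0`, the convention of `Real.rpow`). -/
theorem stmt15 (d : ℕ) (hd : 2 ≤ d) (η ϑ0 : ℝ) (hη : 0 < η) (ν : Fin d → ℝ)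
    (hpos : 0 < -ϑ0 + (∑ l, ν l ^ 2 / (4 * η)) + Real.pi ^ 2 * η * d)
    (α' α τ : ℝ) (h0 : 0 < α') (h1 : α' < 1) (hα : α = (d : ℝ) / 2 - 1 + α') (hτ : 0 ≤ τ)
    (g : ℝ → ℝ)
    (hg : g = fun x : ℝ =>
      (1 - Real.exp (-x)) ^ 2 * Real.exp (-(τ * x)) / (2 * x ^ (1 + α))) :
    ∃ C > 0, ∃ Δ₀ ∈ Set.Ioo (0 : ℝ) 1, ∀ Δ ∈ Set.Ioc (0 : ℝ) Δ₀,
      Summable (fun k : Fin d → ℕ+ =>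
        g ((-ϑ0 + ∑ l, (ν l ^ 2 / (4 * η) + Real.pi ^ 2 * ((k l : ℕ) : ℝ) ^ 2 * η)) * Δ)) ∧
      |Δ ^ ((d : ℝ) / 2) *
            (∑' k : Fin d → ℕ+,
              g ((-ϑ0 + ∑ l, (ν l ^ 2 / (4 * η) + Real.pi ^ 2 * ((k l : ℕ) : ℝ) ^ 2 * η)) * Δ))
          - 1 / 2 * (2 * (τ + 1) ^ α' - τ ^ α' - (τ + 2) ^ α') *
              (Real.Gamma (1 - α') /
                (2 ^ d * (Real.pi * η) ^ ((d : ℝ) / 2) * α' * Real.Gamma ((d : ℝ) / 2)))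
          + ∑ γ ∈ Finset.univ.filter (fun γ : Fin d → Bool =>
              1 ≤ (Finset.univ.filter fun i => γ i = true).card ∧
                (Finset.univ.filter fun i => γ i = true).card ≤ d - 1),
              ∫ z in {x : Fin d → ℝ | ∀ i,
                  (γ i = true → 0 ≤ x i ∧ x i < Real.sqrt Δ / 2) ∧
                    (γ i = false → Real.sqrt Δ / 2 ≤ x i)},
                g (Real.pi ^ 2 * η * ∑ i, z i ^ 2)| ≤
        C * Δ ^ (1 - α') := by
  have hd0 : d ≠ 0 := by lia
  have hd2 : (2 : ℝ) ≤ d := by exact_mod_cast hd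
  have hα0 : 0 ≤ α := by linarith
  have ha : 0 < Real.pi ^ 2 * η := by positivity
  have hg' : g = incrementKernel α τ := hg
  clear hg
  subst hg'
  obtain ⟨C, hC, hmid⟩ := exists_midpoint_bound (c := -ϑ0 + ∑ l, ν l ^ 2 / (4 * η))
    hd0 hα0 hτ ha hpos
  obtain ⟨M, hM, hle⟩ := exists_incrementKernel_mul_le hα0 hτ ha
  have hF := integrable_decayKernel_sum_sq hd0 (α := α) (by linarith) (by linarith)
  have hF0 (y : Fin d → ℝ) : 0 ≤ decayKernel α (∑ i, y i ^ 2) :=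
    decayKernel_nonneg (by positivity)
  have hG0 (y : Fin d → ℝ) : 0 ≤ incrementKernel α τ (Real.pi ^ 2 * η * ∑ i, y i ^ 2) :=
    incrementKernel_nonneg (by positivity)
  have hG : Integrable fun y : Fin d → ℝ =>
      incrementKernel α τ (Real.pi ^ 2 * η * ∑ i, y i ^ 2) := by
    refine (hF.const_mul M).mono'
      ((measurable_incrementKernel α τ).comp (by fun_prop)).aestronglyMeasurable
      (Filter.Eventually.of_forall fun y => ?_)
    rw [Real.norm_of_nonneg (hG0 y)]
    exact (hle _ (by positivity)).1
  set J := ∫ y : Fin d → ℝ, decayKernel α (∑ i, y i ^ 2) with hJ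
  have hJ0 : 0 ≤ J := integral_nonneg hF0
  refine ⟨C * J + M * d * J + 1, by positivity, 1 / 2, by norm_num, fun Δ hΔ => ?_⟩
  have hΔ0 : 0 < Δ := hΔ.1
  set h := √Δ with hh
  have hh0 : 0 < h := Real.sqrt_pos.2 hΔ0
  have hhΔ : h ^ 2 = Δ := Real.sq_sqrt hΔ0.le
  have harg (k : Fin d → ℕ+) :
      (-ϑ0 + ∑ l, (ν l ^ 2 / (4 * η) + Real.pi ^ 2 * ((k l : ℕ) : ℝ) ^ 2 * η)) * Δ
      = (-ϑ0 + ∑ l, ν l ^ 2 / (4 * η) + Real.pi ^ 2 * η * ∑ i, ((k i : ℕ) : ℝ) ^ 2) * h ^ 2 := by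
    rw [hhΔ, Finset.sum_add_distrib, Finset.mul_sum, add_assoc]
    congr 3
    exact Finset.sum_congr rfl fun i _ => by ring
  simp only [harg]
  obtain ⟨hsum, hbound⟩ := summable_and_abs_tsum_sub_integral_le hh0
    (by positivity : 0 ≤ C * h ^ 2) hG hF hF0 (fun k y hy => hmid h hh0 k y hy)
  refine ⟨hsum, ?_⟩
  have hpow : Δ ^ ((d : ℝ) / 2) = h ^ d := by
    rw [hh, Real.sqrt_eq_rpow, ← Real.rpow_natCast, ← Real.rpow_mul hΔ0.le]
    ring_nf
  have hdecomp := integral_orthant_eq hd0 (by positivity : 0 ≤ h / 2) hG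
  rw [integral_incrementKernel_orthant hd0 hη h0 h1 hα hτ] at hdecomp
  have hcorner0 : 0 ≤ ∫ z in orthantPart (h / 2) fun _ : Fin d => true,
      incrementKernel α τ (Real.pi ^ 2 * η * ∑ i, z i ^ 2) := integral_nonneg hG0
  have hcorner : ∫ z in orthantPart (h / 2) fun _ : Fin d => true,
      incrementKernel α τ (Real.pi ^ 2 * η * ∑ i, z i ^ 2) ≤ M * d * Δ * J := by
    calc _ ≤ ∫ z in orthantPart (h / 2) fun _ : Fin d => true,
          M * d * Δ * decayKernel α (∑ i, z i ^ 2) := by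
          refine setIntegral_mono_on hG.integrableOn (hF.const_mul _).integrableOn
            (measurableSet_orthantPart _ _) fun z hz => ?_
          refine (hle _ (by positivity)).2.trans (mul_le_mul_of_nonneg_right ?_ (hF0 z))
          rw [mul_assoc M]
          refine mul_le_mul_of_nonneg_left ?_ hM.le
          have : ∑ i, z i ^ 2 ≤ ∑ _i : Fin d, Δ := Finset.sum_le_sum fun i _ => by
            obtain ⟨hz0, hz1⟩ := (hz i).1 rfl
            rw [← hhΔ]
            exact pow_le_pow_left₀ hz0 (by linarith) 2
          simpa using this
      _ = M * d * Δ * ∫ z in orthantPart (h / 2) fun _ : Fin d => true,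
          decayKernel α (∑ i, z i ^ 2) := integral_const_mul _ _
      _ ≤ M * d * Δ * J := mul_le_mul_of_nonneg_left
          (setIntegral_le_integral hF (Filter.Eventually.of_forall hF0)) (by positivity)
  have hΔle : Δ ≤ Δ ^ (1 - α') := by
    simpa using Real.rpow_le_rpow_of_exponent_ge hΔ0 (by linarith [hΔ.2])
      (by linarith : 1 - α' ≤ 1)
  rw [hpow, hdecomp]
  simp only [orthantPart] at hcorner hcorner0 ⊢
  rw [hhΔ] at hbound ⊢
  have hfin : (C * J + M * d * J + 1) * Δ ≤ (C * J + M * d * J + 1) * Δ ^ (1 - α') := by gcongr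
  refine le_trans ?_ hfin
  rw [abs_le] at hbound ⊢
  constructor <;> linarith
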